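/- Let R be a commutative noetherian ring and C a semidualizing R-module. An R-module M is C-flat C-cotorsion if and only if M is G_C-flat and M has finite C-flat C-cotorsion projective dimension. -/

import Mathlib

open CategoryTheory TensorProduct

universe u

section
variable (R : Type u) [CommRing R]

def extZero (M N : ModuleCat.{u} R) : Prop :=
  ∀ i : ℕ, 1 ≤ i → Subsingleton (((Ext R (ModuleCat.{u} R) i).obj (Opposite.op M)).obj N)

def torZero (M N : ModuleCat.{u} R) : Prop :=
  ∀ i : ℕ, 1 ≤ i → Subsingleton (((Tor (ModuleCat.{u} R) i).obj M).obj N)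

def IsSemidualizing (C : ModuleCat.{u} R) : Prop :=
  Module.Finite R C ∧ Function.Bijective (LinearMap.lsmul R C) ∧ extZero R C C

/-- A module is `C`-flat if it is isomorphic to `F ⊗[R] C` with `F` flat. -/
def IsCFlat (C M : ModuleCat.{u} R) : Prop :=
  ∃ F : ModuleCat.{u} R, Module.Flat R F ∧ Nonempty (M ≃ₗ[R] (F ⊗[R] C))

def IsCInjective (C M : ModuleCat.{u} R) : Prop :=
  ∃ I : ModuleCat.{u} R, Module.Injective R I ∧ Nonempty (M ≃ₗ[R] (↥C →ₗ[R] ↥I))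

/-- cotorsion: `Ext^{≥1}(F, N) = 0` for all flat `F`. -/
def IsCotorsion (N : ModuleCat.{u} R) : Prop :=
  ∀ F : ModuleCat.{u} R, Module.Flat R F → extZero R F N

/-- `C`-cotorsion: `Ext^{≥1}(F ⊗ C, N) = 0` for all flat `F`. -/
def IsCCotorsion (C N : ModuleCat.{u} R) : Prop :=
  ∀ F : ModuleCat.{u} R, Module.Flat R F →
    extZero R (ModuleCat.of R (↥F ⊗[R] ↥C)) N

/-- `C`-flat `C`-cotorsion: isomorphic to `F ⊗ C` with `F` flat and cotorsion. -/
def IsCFlatCotorsion (C M : ModuleCat.{u} R) : Prop :=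
  ∃ F : ModuleCat.{u} R, Module.Flat R F ∧ IsCotorsion R F ∧
    Nonempty (M ≃ₗ[R] (F ⊗[R] C))

/-- The natural evaluation map `C ⊗ Hom(C,M) → M`. -/
noncomputable def evalMap (C M : ModuleCat.{u} R) :
    (↥C ⊗[R] (↥C →ₗ[R] ↥M)) →ₗ[R] ↥M :=
  TensorProduct.lift (LinearMap.id (R := R) (M := ↥C →ₗ[R] ↥M)).flip

/-- The Bass class `B_C(R)`. -/
noncomputable def InBassClass (C M : ModuleCat.{u} R) : Prop :=
  extZero R C M ∧
  torZero R C (ModuleCat.of R (↥C →ₗ[R] ↥M)) ∧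
  Function.Bijective (evalMap R C M)

/-- A `ℤ`-indexed complex of `R`-modules: `d i : X (i+1) → X i`. -/
structure ZComplex where
  X : ℤ → ModuleCat.{u} R
  d : ∀ i : ℤ, ↥(X (i + 1)) →ₗ[R] ↥(X i)
  d_comp_d : ∀ i : ℤ, (d i).comp (d (i + 1)) = 0

namespace ZComplex

variable {R} (Z : ZComplex R)

/-- Exactness of the complex. -/
def IsExact : Prop := ∀ i : ℤ, Function.Exact (Z.d (i + 1)) (Z.d i)

/-- Exactness of `Z ⊗[R] J`. -/
def TensorExact (J : ModuleCat.{u} R) : Prop :=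
  ∀ i : ℤ, Function.Exact (LinearMap.rTensor (↥J) (Z.d (i + 1)))
    (LinearMap.rTensor (↥J) (Z.d i))

/-- Exactness of `Hom_R(V, Z)`. -/
def HomFromExact (V : ModuleCat.{u} R) : Prop :=
  ∀ i : ℤ, Function.Exact
    (fun f : ↥V →ₗ[R] ↥(Z.X (i + 1 + 1)) => (Z.d (i + 1)).comp f)
    (fun f : ↥V →ₗ[R] ↥(Z.X (i + 1)) => (Z.d i).comp f)

/-- Exactness of `Hom_R(Z, V)`. -/
def HomToExact (V : ModuleCat.{u} R) : Prop :=
  ∀ i : ℤ, Function.Exact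
    (fun g : ↥(Z.X i) →ₗ[R] ↥V => g.comp (Z.d i))
    (fun g : ↥(Z.X (i + 1)) →ₗ[R] ↥V => g.comp (Z.d (i + 1)))

/-- `M ≅ Coker(∂₁)`. -/
def IsCokerOfD1 (M : ModuleCat.{u} R) : Prop :=
  Nonempty (↥M ≃ₗ[R] (↥(Z.X 0) ⧸ LinearMap.range (Z.d 0)))

end ZComplex

end

section
variable (R : Type u) [CommRing R]

/-- A complete `FF_C`-resolution witnessing that `M` is `G_C`-flat. -/
def IsGCFlat (C M : ModuleCat.{u} R) : Prop :=
  ∃ Z : ZComplex R, Z.IsExact ∧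
    (∀ i : ℤ, 0 ≤ i → Module.Flat R (Z.X i)) ∧
    (∀ i : ℤ, i < 0 → IsCFlat R C (Z.X i)) ∧
    (∀ J : ModuleCat.{u} R, IsCInjective R C J → Z.TensorExact J) ∧
    Z.IsCokerOfD1 M

def IsCProjective (C M : ModuleCat.{u} R) : Prop :=
  ∃ P : ModuleCat.{u} R, Module.Projective R P ∧ Nonempty (M ≃ₗ[R] (P ⊗[R] C))

/-- A complete `PP_C`-resolution witnessing that `M` is `G_C`-projective. -/
def IsGCProjective (C M : ModuleCat.{u} R) : Prop :=
  ∃ Z : ZComplex R, Z.IsExact ∧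
    (∀ i : ℤ, 0 ≤ i → Module.Projective R (Z.X i)) ∧
    (∀ i : ℤ, i < 0 → IsCProjective R C (Z.X i)) ∧
    (∀ Q : ModuleCat.{u} R, IsCProjective R C Q → Z.HomToExact Q) ∧
    Z.IsCokerOfD1 M

/-- `G(𝒳)` for a class `𝒳` of modules. -/
def GClass (𝒳 : ModuleCat.{u} R → Prop) (M : ModuleCat.{u} R) : Prop :=
  ∃ Z : ZComplex R, Z.IsExact ∧
    (∀ i : ℤ, 𝒳 (Z.X i)) ∧
    (∀ V : ModuleCat.{u} R, 𝒳 V → Z.HomFromExact V) ∧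
    (∀ V : ModuleCat.{u} R, 𝒳 V → Z.HomToExact V) ∧
    Z.IsCokerOfD1 M

/-- Iterates `G^n(𝒳)`, with `G^0(𝒳) = 𝒳`. -/
def GIter : ℕ → (ModuleCat.{u} R → Prop) → (ModuleCat.{u} R → Prop)
  | 0, 𝒳 => 𝒳
  | n + 1, 𝒳 => GClass R (GIter n 𝒳)

/-- `H_C(𝒳)`: modules with a `P_C F_C^cot`-complete `𝒳`-resolution. -/
def HClass (C : ModuleCat.{u} R) (𝒳 : ModuleCat.{u} R → Prop) (M : ModuleCat.{u} R) : Prop :=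
  ∃ Z : ZComplex R, Z.IsExact ∧
    (∀ i : ℤ, 𝒳 (Z.X i)) ∧
    (∀ P : ModuleCat.{u} R, Module.Projective R P →
      Z.HomFromExact (ModuleCat.of R (↥P ⊗[R] ↥C))) ∧
    (∀ N : ModuleCat.{u} R, IsCFlatCotorsion R C N → Z.HomToExact N) ∧
    Z.IsCokerOfD1 M

/-- Iterates `H_C^n(𝒳)`, with `H_C^0(𝒳) = 𝒳`. -/
def HIter (C : ModuleCat.{u} R) : ℕ → (ModuleCat.{u} R → Prop) → (ModuleCat.{u} R → Prop)
  | 0, 𝒳 => 𝒳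
  | n + 1, 𝒳 => HClass R C (HIter C n 𝒳)

/-- `M` admits a resolution `0 → X_n → ⋯ → X_0 → M → 0` with each `X_i` in `𝒳`. -/
def HasResOfLength (𝒳 : ModuleCat.{u} R → Prop) (n : ℕ) (M : ModuleCat.{u} R) : Prop :=
  ∃ (P : ℕ → ModuleCat.{u} R) (d : ∀ i : ℕ, ↥(P (i + 1)) →ₗ[R] ↥(P i))
    (ε : ↥(P 0) →ₗ[R] ↥M),
      Function.Surjective ε ∧ Function.Exact (d 0) ε ∧
      (∀ i : ℕ, Function.Exact (d (i + 1)) (d i)) ∧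
      (∀ i : ℕ, i ≤ n → 𝒳 (P i)) ∧
      (∀ i : ℕ, n < i → Subsingleton (P i))

/-- `M` admits a coresolution `0 → M → Y_0 → ⋯ → Y_n → 0` with each `Y_i` in `𝒳`. -/
def HasCoresOfLength (𝒳 : ModuleCat.{u} R → Prop) (n : ℕ) (M : ModuleCat.{u} R) : Prop :=
  ∃ (P : ℕ → ModuleCat.{u} R) (d : ∀ i : ℕ, ↥(P i) →ₗ[R] ↥(P (i + 1)))
    (η : ↥M →ₗ[R] ↥(P 0)),
      Function.Injective η ∧ Function.Exact η (d 0) ∧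
      (∀ i : ℕ, Function.Exact (d i) (d (i + 1))) ∧
      (∀ i : ℕ, i ≤ n → 𝒳 (P i)) ∧
      (∀ i : ℕ, n < i → Subsingleton (P i))

/-- `C` is a dualizing module: semidualizing of finite injective dimension. -/
def IsDualizing (C : ModuleCat.{u} R) : Prop :=
  IsSemidualizing R C ∧
  ∃ n : ℕ, HasCoresOfLength R (fun I => Module.Injective R ↥I) n C

end

section ExtVanishing

variable {R : Type u} [CommRing R]

lemma extFunctor_subsingleton_iff (M N : ModuleCat.{u} R) (n : ℕ) :
    Subsingleton (((Ext R (ModuleCat.{u} R) (n + 1)).obj (Opposite.op M)).obj N) ↔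
      Subsingleton (Abelian.Ext.{u} M N (n + 1)) := by
  let P := projectiveResolution M
  have h₁ : Subsingleton (((Ext R (ModuleCat.{u} R) (n + 1)).obj (Opposite.op M)).obj N) ↔
      ∀ f : P.complex.X (n + 1) ⟶ N, P.complex.d (n + 2) (n + 1) ≫ f = 0 →
        ∃ g : P.complex.X n ⟶ N, P.complex.d (n + 1) n ≫ g = f := by
    rw [← ModuleCat.isZero_iff_subsingleton, (P.isoExt (R := R) (n + 1) N).isZero_iff,
      ← HomologicalComplex.exactAt_iff_isZero_homology,
      HomologicalComplex.exactAt_iff' _ n (n + 1) (n + 2) (by simp) (by simp),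
      ShortComplex.moduleCat_exact_iff]
    rfl
  rw [h₁]
  constructor
  · intro h
    refine subsingleton_of_forall_eq 0 fun α => ?_
    obtain ⟨f, hf, rfl⟩ := P.extMk_surjective α (n + 2) rfl
    exact (P.extMk_eq_zero_iff f (n + 2) rfl hf n rfl).2 (h f hf)
  · intro h f hf
    exact (P.extMk_eq_zero_iff f (n + 2) rfl hf n rfl).1 (Subsingleton.elim _ _)

/-- Vanishing of all positive-degree `Ext`-groups. -/
def ExtVanishes (R : Type u) [CommRing R] (M Y : Type u) [AddCommGroup M] [Module R M]
    [AddCommGroup Y] [Module R Y] : Prop :=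
  ∀ n : ℕ, Subsingleton (Abelian.Ext.{u} (ModuleCat.of R M) (ModuleCat.of R Y) (n + 1))

lemma extZero_iff_extVanishes (M N : ModuleCat.{u} R) : extZero R M N ↔ ExtVanishes R M N := by
  refine ⟨fun h n => (extFunctor_subsingleton_iff M N n).1 (h _ (by lia)), fun h i hi => ?_⟩
  obtain ⟨n, rfl⟩ : ∃ n, i = n + 1 := ⟨i - 1, by lia⟩
  exact (extFunctor_subsingleton_iff M N n).2 (h n)

variable {A B D Y : Type u} [AddCommGroup A] [Module R A] [AddCommGroup B] [Module R B]
  [AddCommGroup D] [Module R D] [AddCommGroup Y] [Module R Y]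

lemma ExtVanishes.of_projective [Module.Projective R A] : ExtVanishes R A Y := fun n =>
  have : Projective (ModuleCat.of R A) := (IsProjective.iff_projective _).1 ‹_›
  subsingleton_of_forall_eq 0 fun _ => Abelian.Ext.eq_zero_of_projective _

lemma ExtVanishes.of_linearEquiv (e : A ≃ₗ[R] B) (h : ExtVanishes R A Y) :
    ExtVanishes R B Y := fun n =>
  (((Abelian.extFunctor (n + 1)).mapIso e.symm.toModuleIso.op).app
    (ModuleCat.of R Y)).addCommGroupIsoToAddEquiv.toEquiv.subsingleton_congr.1 (h n)

variable {f : A →ₗ[R] B} {g : B →ₗ[R] D}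

/-- The short complex of modules attached to an exact pair of linear maps. -/
abbrev exactShortComplex (hfg : Function.Exact f g) : ShortComplex (ModuleCat.{u} R) :=
  ShortComplex.mk (ModuleCat.ofHom f) (ModuleCat.ofHom g)
    (ModuleCat.hom_ext (DFunLike.ext _ _ hfg.apply_apply_eq_zero))

lemma exactShortComplex_shortExact (hf : Function.Injective f) (hfg : Function.Exact f g)
    (hg : Function.Surjective g) : (exactShortComplex hfg).ShortExact where
  exact := (ShortComplex.ShortExact.moduleCat_exact_iff_function_exact _).2 hfg
  mono_f := (ModuleCat.mono_iff_injective _).2 hf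
  epi_g := (ModuleCat.epi_iff_surjective _).2 hg

lemma subsingleton_ext_one_of_lcomp_surjective (hf : Function.Injective f)
    (hfg : Function.Exact f g) (hg : Function.Surjective g)
    (hB : ExtVanishes R B Y) (h : Function.Surjective (f.lcomp R Y)) :
    Subsingleton (Abelian.Ext.{u} (ModuleCat.of R D) (ModuleCat.of R Y) 1) := by
  have hS := exactShortComplex_shortExact hf hfg hg
  refine subsingleton_of_forall_eq 0 fun x => ?_
  have := hB 0
  obtain ⟨y, rfl⟩ := Abelian.Ext.contravariant_sequence_exact₃ hS (ModuleCat.of R Y) x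
    (Subsingleton.elim (α := Abelian.Ext (ModuleCat.of R B) (ModuleCat.of R Y) (0 + 1)) _ _)
    (n₀ := 0) rfl
  obtain ⟨y, rfl⟩ := Abelian.Ext.homEquiv₀.symm.surjective y
  obtain ⟨z, hz⟩ := h y.hom
  have : y = (exactShortComplex hfg).f ≫ ModuleCat.ofHom z :=
    ModuleCat.hom_ext hz.symm
  subst this
  rw [Abelian.Ext.homEquiv₀_symm_apply, ← Abelian.Ext.mk₀_comp_mk₀,
    ← Abelian.Ext.comp_assoc_of_second_deg_zero, hS.extClass_comp]
  simp

lemma lcomp_surjective_of_extVanishes (hf : Function.Injective f)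
    (hfg : Function.Exact f g) (hg : Function.Surjective g)
    (hD : ExtVanishes R D Y) : Function.Surjective (f.lcomp R Y) := by
  have hS := exactShortComplex_shortExact hf hfg hg
  intro y
  have := hD 0
  obtain ⟨z, hz⟩ := Abelian.Ext.contravariant_sequence_exact₁ hS (ModuleCat.of R Y)
    (Abelian.Ext.mk₀ (ModuleCat.ofHom y)) (n₁ := 1) rfl
    (Subsingleton.elim (α := Abelian.Ext (ModuleCat.of R D) (ModuleCat.of R Y) (0 + 1)) _ _)
  obtain ⟨z, rfl⟩ := Abelian.Ext.homEquiv₀.symm.surjective z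
  rw [Abelian.Ext.homEquiv₀_symm_apply, Abelian.Ext.mk₀_comp_mk₀] at hz
  have := (Abelian.Ext.mk₀_bijective _ _).1 hz
  exact ⟨z.hom, congrArg ModuleCat.Hom.hom this⟩

lemma subsingleton_ext_succ_right (hf : Function.Injective f)
    (hfg : Function.Exact f g) (hg : Function.Surjective g)
    (hB : ExtVanishes R B Y) (n : ℕ)
    (h : Subsingleton (Abelian.Ext.{u} (ModuleCat.of R A) (ModuleCat.of R Y) n)) :
    Subsingleton (Abelian.Ext.{u} (ModuleCat.of R D) (ModuleCat.of R Y) (n + 1)) := by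
  have hS := exactShortComplex_shortExact hf hfg hg
  refine subsingleton_of_forall_eq 0 fun x => ?_
  have := hB n
  obtain ⟨y, rfl⟩ := Abelian.Ext.contravariant_sequence_exact₃ hS (ModuleCat.of R Y) x
    (Subsingleton.elim (α := Abelian.Ext (ModuleCat.of R B) (ModuleCat.of R Y) (n + 1)) _ _)
    (n₀ := n) (add_comm _ _)
  rw [Subsingleton.elim (α := Abelian.Ext (ModuleCat.of R A) (ModuleCat.of R Y) n) y 0]
  simp

lemma ExtVanishes.kernel (hf : Function.Injective f)
    (hfg : Function.Exact f g) (hg : Function.Surjective g)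
    (hB : ExtVanishes R B Y) (hD : ExtVanishes R D Y) : ExtVanishes R A Y := by
  have hS := exactShortComplex_shortExact hf hfg hg
  intro n
  refine subsingleton_of_forall_eq 0 fun x => ?_
  have := hB n
  have := hD (n + 1)
  obtain ⟨y, rfl⟩ := Abelian.Ext.contravariant_sequence_exact₁ hS (ModuleCat.of R Y) x
    (n₁ := n + 1 + 1) (add_comm _ _)
    (Subsingleton.elim (α := Abelian.Ext (ModuleCat.of R D) (ModuleCat.of R Y) _) _ _)
  rw [Subsingleton.elim (α := Abelian.Ext (ModuleCat.of R B) (ModuleCat.of R Y) _) y 0]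
  simp

lemma ExtVanishes.cokernel (hf : Function.Injective f)
    (hfg : Function.Exact f g) (hg : Function.Surjective g)
    (hA : ExtVanishes R Y A) (hB : ExtVanishes R Y B) : ExtVanishes R Y D := by
  have hS := exactShortComplex_shortExact hf hfg hg
  intro n
  refine subsingleton_of_forall_eq 0 fun x => ?_
  have := hA (n + 1)
  have := hB n
  obtain ⟨y, rfl⟩ := Abelian.Ext.covariant_sequence_exact₃ (ModuleCat.of R Y) hS x
    (n₁ := n + 1 + 1) rfl
    (Subsingleton.elim (α := Abelian.Ext (ModuleCat.of R Y) (ModuleCat.of R A) _) _ _)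
  rw [Subsingleton.elim (α := Abelian.Ext (ModuleCat.of R Y) (ModuleCat.of R B) _) y 0]
  simp

end ExtVanishing

section FlatVanishing

variable {R : Type u} [CommRing R]

lemma flat_of_exact {A B D : Type u} [AddCommGroup A] [Module R A] [AddCommGroup B] [Module R B]
    [AddCommGroup D] [Module R D] [Module.Flat R B] [Module.Flat R D] {f : A →ₗ[R] B}
    {g : B →ₗ[R] D} (hf : Function.Injective f) (hfg : Function.Exact f g)
    (hg : Function.Surjective g) : Module.Flat R A := by
  rw [Module.Flat.iff_lTensor_preserves_injective_linearMap]
  intro N N' _ _ _ _ j hj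
  have h₁ := (LinearMap.lTensor_inj_iff_rTensor_inj N f).1
    (LinearMap.lTensor_injective_of_exact_of_flat g hg f hf hfg N)
  have h₂ : Function.Injective (j.lTensor B) :=
    Module.Flat.lTensor_preserves_injective_linearMap _ hj
  have h := h₂.comp h₁
  rw [← LinearMap.coe_comp, LinearMap.lTensor_comp_rTensor, ← LinearMap.rTensor_comp_lTensor,
    LinearMap.coe_comp] at h
  exact h.of_comp

lemma subsingleton_ext_one_characterModule {A B D J : Type u} [AddCommGroup A] [Module R A]
    [AddCommGroup B] [Module R B] [AddCommGroup D] [Module R D] [AddCommGroup J] [Module R J]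
    {f : A →ₗ[R] B} {g : B →ₗ[R] D} (hf : Function.Injective f) (hfg : Function.Exact f g)
    (hg : Function.Surjective g) (hB : ExtVanishes R B (CharacterModule J))
    (hJ : Function.Injective (f.rTensor J)) :
    Subsingleton (Abelian.Ext.{u} (ModuleCat.of R D) (ModuleCat.of R (CharacterModule J)) 1) :=
  subsingleton_ext_one_of_lcomp_surjective hf hfg hg hB
    (rTensor_injective_iff_lcomp_surjective.1 hJ)

lemma extVanishes_characterModule_of_flat (J : Type u) [AddCommGroup J] [Module R J]
    (P : Type u) [AddCommGroup P] [Module R P] [Module.Flat R P] :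
    ExtVanishes R P (CharacterModule J) := by
  intro n
  induction n generalizing P with
  | zero =>
    let g : (P →₀ R) →ₗ[R] P := Finsupp.linearCombination R id
    have hg : Function.Surjective g := Finsupp.linearCombination_id_surjective R P
    have hJ : Function.Injective ((LinearMap.ker g).subtype.rTensor J) :=
      (LinearMap.lTensor_inj_iff_rTensor_inj J _).1 <|
        LinearMap.lTensor_injective_of_exact_of_flat g hg _ (Submodule.injective_subtype _)
          (LinearMap.exact_subtype_ker_map g) J
    exact subsingleton_ext_one_characterModule (Submodule.injective_subtype _)
      (LinearMap.exact_subtype_ker_map g) hg .of_projective hJ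
  | succ n ih =>
    let g : (P →₀ R) →ₗ[R] P := Finsupp.linearCombination R id
    have hg : Function.Surjective g := Finsupp.linearCombination_id_surjective R P
    have : Module.Flat R (LinearMap.ker g) := flat_of_exact (Submodule.injective_subtype _)
      (LinearMap.exact_subtype_ker_map g) hg
    exact subsingleton_ext_succ_right (Submodule.injective_subtype _)
      (LinearMap.exact_subtype_ker_map g) hg .of_projective _ (ih _)

end FlatVanishing

section HomEval

lemma exact_lcomp_of_injective {R : Type u} [CommRing R] {X Y Z I : Type u} [AddCommGroup X]
    [Module R X] [AddCommGroup Y] [Module R Y] [AddCommGroup Z] [Module R Z] [AddCommGroup I]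
    [Module R I] [Module.Injective R I] {f : X →ₗ[R] Y} {g : Y →ₗ[R] Z}
    (hfg : Function.Exact f g) : Function.Exact (g.lcomp R I) (f.lcomp R I) := by
  intro ψ
  constructor
  · intro hψ
    have hker : LinearMap.ker g ≤ LinearMap.ker ψ := by
      intro y hy
      obtain ⟨x, rfl⟩ := (hfg y).1 hy
      exact LinearMap.congr_fun hψ x
    obtain ⟨h, hh⟩ := Module.Injective.out ((LinearMap.ker g).liftQ g le_rfl)
      (LinearMap.ker_eq_bot.1 (Submodule.ker_liftQ_eq_bot _ _ _ le_rfl))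
      ((LinearMap.ker g).liftQ ψ hker)
    exact ⟨h, LinearMap.ext fun y => hh (Submodule.Quotient.mk y)⟩
  · rintro ⟨φ, rfl⟩
    ext x
    simp [hfg.apply_apply_eq_zero]

lemma exists_finite_free_presentation (R : Type u) [CommRing R] [IsNoetherianRing R] (S : Type u)
    [AddCommGroup S] [Module R S] [Module.Finite R S] :
    ∃ (m n : ℕ) (p : (Fin m → R) →ₗ[R] (Fin n → R)) (q : (Fin n → R) →ₗ[R] S),
      Function.Exact p q ∧ Function.Surjective q := by
  obtain ⟨n, q, hq⟩ := Module.Finite.exists_fin' R S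
  obtain ⟨m, p, hp⟩ := Module.Finite.exists_fin' R (LinearMap.ker q)
  refine ⟨m, n, (LinearMap.ker q).subtype ∘ₗ p, q, ?_, hq⟩
  rw [LinearMap.exact_iff, LinearMap.range_comp, LinearMap.range_eq_top.2 hp, Submodule.map_top,
    Submodule.range_subtype]

variable {R : Type u} [CommRing R] (A I : Type u) [AddCommGroup A] [Module R A]
  [AddCommGroup I] [Module R I]

/-- The natural map `S ⊗ Hom(A, I) → Hom(Hom(S, A), I)`. -/
noncomputable def tensorHomEval (S : Type u) [AddCommGroup S] [Module R S] :
    S ⊗[R] (A →ₗ[R] I) →ₗ[R] ((S →ₗ[R] A) →ₗ[R] I) :=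
  TensorProduct.lift (LinearMap.mk₂ R (fun s φ => φ.comp (LinearMap.applyₗ s))
    (fun _ _ _ => by ext; simp) (fun _ _ _ => by ext; simp)
    (fun _ _ _ => by ext; simp) (fun _ _ _ => by ext; simp))

@[simp]
lemma tensorHomEval_tmul_apply (S : Type u) [AddCommGroup S] [Module R S] (s : S)
    (φ : A →ₗ[R] I) (α : S →ₗ[R] A) : tensorHomEval A I S (s ⊗ₜ φ) α = φ (α s) := rfl

lemma tensorHomEval_naturality {S T : Type u} [AddCommGroup S] [Module R S] [AddCommGroup T]
    [Module R T] (f : S →ₗ[R] T) :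
    ((f.lcomp R A).lcomp R I) ∘ₗ tensorHomEval A I S =
      tensorHomEval A I T ∘ₗ f.rTensor (A →ₗ[R] I) := by
  ext; simp

lemma tensorHomEval_bijective_of_pi (n : ℕ) :
    Function.Bijective (tensorHomEval (R := R) A I (Fin n → R)) := by
  have hsum (s : Fin n → R) : ∑ i, s i • Pi.single i (1 : R) = s := by
    ext j; simp [Finset.sum_apply, Pi.single_apply]
  refine Function.bijective_iff_has_inverse.2
    ⟨fun ψ => ∑ i, Pi.single i (1 : R) ⊗ₜ
      (ψ ∘ₗ LinearMap.smulRightₗ (LinearMap.proj i : (Fin n → R) →ₗ[R] R)), ?_, ?_⟩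
  · intro x
    induction x with
    | zero => simp
    | add x y hx hy =>
      simp only [map_add, LinearMap.add_comp, TensorProduct.tmul_add, Finset.sum_add_distrib] at *
      rw [hx, hy]
    | tmul s φ =>
      have h (i : Fin n) : tensorHomEval A I (Fin n → R) (s ⊗ₜ φ) ∘ₗ
          LinearMap.smulRightₗ (LinearMap.proj i : (Fin n → R) →ₗ[R] R) = s i • φ := by
        ext; simp
      simp only [h]
      simp only [TensorProduct.tmul_smul, TensorProduct.smul_tmul', ← TensorProduct.sum_tmul,
        hsum]
  · intro ψ
    ext α
    simp only [map_sum, LinearMap.sum_apply, tensorHomEval_tmul_apply, LinearMap.comp_apply]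
    rw [← map_sum]
    congr 1
    refine LinearMap.ext fun s => ?_
    conv_rhs => rw [← hsum s, map_sum]
    simp

lemma tensorHomEval_bijective [IsNoetherianRing R] [Module.Injective R I] (S : Type u)
    [AddCommGroup S] [Module R S] [Module.Finite R S] :
    Function.Bijective (tensorHomEval (R := R) A I S) := by
  obtain ⟨m, n, p, q, hpq, hq⟩ := exists_finite_free_presentation R S
  refine LinearMap.bijective_of_surjective_of_bijective_of_right_exact
    (p.rTensor (A →ₗ[R] I)) (q.rTensor (A →ₗ[R] I)) ((p.lcomp R A).lcomp R I)
    ((q.lcomp R A).lcomp R I) _ _ _ (tensorHomEval_naturality A I p)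
    (tensorHomEval_naturality A I q) (rTensor_exact _ hpq hq)
    (exact_lcomp_of_injective (LinearMap.exact_lcomp_of_exact_of_surjective A hpq hq))
    (tensorHomEval_bijective_of_pi A I m).2 (tensorHomEval_bijective_of_pi A I n)
    (LinearMap.rTensor_surjective _ hq) ?_
  intro ψ
  obtain ⟨h, hh⟩ := Module.Injective.out (q.lcomp R A)
    (LinearMap.lcomp_injective_of_surjective q hq) ψ
  exact ⟨h, LinearMap.ext hh⟩

/-- `Hom(-, I)`-duality turns surjectivity of restriction into injectivity of the tensor map. -/
lemma rTensor_hom_injective [IsNoetherianRing R] [Module.Injective R I] {S T : Type u}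
    [AddCommGroup S] [Module R S] [Module.Finite R S] [AddCommGroup T] [Module R T]
    (f : S →ₗ[R] T) (h : Function.Surjective (f.lcomp R A)) :
    Function.Injective (f.rTensor (A →ₗ[R] I)) := by
  have h₁ := (LinearMap.lcomp_injective_of_surjective (S := R) (N := I) _ h).comp
    (tensorHomEval_bijective A I S).1
  rw [← LinearMap.coe_comp, tensorHomEval_naturality, LinearMap.coe_comp] at h₁
  exact h₁.of_comp

lemma lTensorHomToHomLTensor_bijective [IsNoetherianRing R] (F S : Type u) [AddCommGroup F]
    [Module R F] [Module.Flat R F] [AddCommGroup S] [Module R S] [Module.Finite R S] :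
    Function.Bijective (lTensorHomToHomLTensor (.id R) S F A) := by
  obtain ⟨m, n, p, q, hpq, hq⟩ := exists_finite_free_presentation R S
  have hfree (k : ℕ) : Function.Bijective (lTensorHomToHomLTensor (.id R) (Fin k → R) F A) := by
    rw [← lTensorHomEquivHomLTensor_toLinearMap]
    exact (lTensorHomEquivHomLTensor R _ F A).bijective
  exact LinearMap.bijective_of_bijective_of_injective_of_left_exact
    ((q.lcomp R A).lTensor F) ((p.lcomp R A).lTensor F) (q.lcomp R (F ⊗[R] A))
    (p.lcomp R (F ⊗[R] A)) _ _ _ (by ext; simp) (by ext; simp)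
    (Module.Flat.lTensor_exact F (LinearMap.exact_lcomp_of_exact_of_surjective A hpq hq))
    (LinearMap.exact_lcomp_of_exact_of_surjective _ hpq hq) (hfree n) (hfree m).1
    (Module.Flat.lTensor_preserves_injective_linearMap _
      (LinearMap.lcomp_injective_of_surjective q hq))
    (LinearMap.lcomp_injective_of_surjective q hq)

end HomEval

section Resolution

variable {R : Type u} [CommRing R]

lemma exact_comp_comp {S P S' P' P'' : Type u} [AddCommGroup S] [Module R S] [AddCommGroup P]
    [Module R P] [AddCommGroup S'] [Module R S'] [AddCommGroup P'] [Module R P']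
    [AddCommGroup P''] [Module R P''] {p : P'' →ₗ[R] S} {i : S →ₗ[R] P'} {q : P' →ₗ[R] S'}
    {j : S' →ₗ[R] P} (hp : Function.Surjective p) (hiq : Function.Exact i q)
    (hj : Function.Injective j) : Function.Exact (i ∘ₗ p) (j ∘ₗ q) := by
  rw [LinearMap.exact_iff, LinearMap.range_comp, LinearMap.range_eq_top.2 hp, Submodule.map_top,
    LinearMap.ker_comp, LinearMap.ker_eq_bot.2 hj, ← LinearMap.ker, hiq.linearMap_ker_eq]

lemma exists_syzygy [IsNoetherianRing R] (C S : Type u) [AddCommGroup C] [Module R C]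
    [AddCommGroup S] [Module R S] [Module.Finite R S] (hS : ExtVanishes R S C) :
    ∃ (T P : ModuleCat.{u} R) (i : T →ₗ[R] P) (p : P →ₗ[R] S),
      (Module.Finite R T ∧ ExtVanishes R T C) ∧ Module.Free R P ∧ Function.Injective i ∧
      Function.Exact i p ∧ Function.Surjective p ∧
      ∀ (I : Type u) [AddCommGroup I] [Module R I] [Module.Injective R I],
        Function.Injective (i.rTensor (C →ₗ[R] I)) := by
  obtain ⟨n, q, hq⟩ := Module.Finite.exists_fin' R S
  have hi := Submodule.injective_subtype (LinearMap.ker q)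
  have hiq := LinearMap.exact_subtype_ker_map q
  exact ⟨ModuleCat.of R (LinearMap.ker q), ModuleCat.of R (Fin n → R),
    (LinearMap.ker q).subtype, q,
    ⟨inferInstanceAs (Module.Finite R (LinearMap.ker q)), .kernel hi hiq hq .of_projective hS⟩,
    inferInstanceAs (Module.Free R (Fin n → R)), hi, hiq, hq,
    fun I _ _ _ => rTensor_hom_injective C I _ (lcomp_surjective_of_extVanishes hi hiq hq hS)⟩

lemma exists_free_resolution [IsNoetherianRing R] (C : ModuleCat.{u} R) [Module.Finite R C]
    (hC : ExtVanishes R C C) :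
    ∃ (P : ℕ → ModuleCat.{u} R) (d : ∀ i, P (i + 1) →ₗ[R] P i) (ε : P 0 →ₗ[R] C),
      (∀ i, Module.Free R (P i)) ∧ Function.Surjective ε ∧ Function.Exact (d 0) ε ∧
      (∀ i, Function.Exact (d (i + 1)) (d i)) ∧
      ∀ (I : Type u) [AddCommGroup I] [Module R I] [Module.Injective R I] (i : ℕ),
        Function.Exact ((d (i + 1)).rTensor (C →ₗ[R] I)) ((d i).rTensor (C →ₗ[R] I)) := by
  let Syz := {S : ModuleCat.{u} R // Module.Finite R S ∧ ExtVanishes R S C}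
  have step (S : Syz) : ∃ (T : Syz) (P : ModuleCat.{u} R) (i : T.1 →ₗ[R] P) (p : P →ₗ[R] S.1),
      Module.Free R P ∧ Function.Injective i ∧
      Function.Exact i p ∧ Function.Surjective p ∧
      ∀ (I : Type u) [AddCommGroup I] [Module R I] [Module.Injective R I],
        Function.Injective (i.rTensor (C →ₗ[R] I)) := by
    have := S.2.1
    obtain ⟨T, P, i, p, hT, h⟩ := exists_syzygy C S.1 S.2.2
    exact ⟨⟨T, hT⟩, P, i, p, h⟩
  choose next P i p hP hi hip hp hI using step
  let S (k : ℕ) : Syz := Nat.rec ⟨C, ‹_›, hC⟩ (fun _ => next) k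
  refine ⟨fun k => P (S k), fun k => i (S k) ∘ₗ p (S (k + 1)), p (S 0), fun k => hP _, hp _,
    ?_, fun k => exact_comp_comp (hp _) (hip _) (hi _), fun I _ _ _ k => ?_⟩
  · have h := exact_comp_comp (j := LinearMap.id) (hp (S 1)) (hip (S 0)) Function.injective_id
    rwa [LinearMap.id_comp] at h
  · rw [LinearMap.rTensor_comp, LinearMap.rTensor_comp]
    exact exact_comp_comp (LinearMap.rTensor_surjective _ (hp _))
      (rTensor_exact _ (hip _) (hp _)) (hI _ I)

variable {P : ℕ → ModuleCat.{u} R} (N : ModuleCat.{u} R)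

/-- The terms of a left resolution of `N`, followed by `N` in degree `-1`. -/
def augmentedX (P : ℕ → ModuleCat.{u} R) (N : ModuleCat.{u} R) : ℤ → ModuleCat.{u} R
  | .ofNat n => P n
  | .negSucc 0 => N
  | .negSucc (_ + 1) => ModuleCat.of R PUnit.{u + 1}

/-- The differentials of a left resolution augmented by its target. -/
def augmentedD (d : ∀ i, P (i + 1) →ₗ[R] P i) (ε : P 0 →ₗ[R] N) :
    ∀ i : ℤ, augmentedX P N (i + 1) →ₗ[R] augmentedX P N i
  | .ofNat n => d n
  | .negSucc 0 => ε
  | .negSucc (_ + 1) => 0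

variable {N}

lemma augmentedD_rel_succ (d : ∀ i, P (i + 1) →ₗ[R] P i) (ε : P 0 →ₗ[R] N)
    (T : ∀ {A B D : ModuleCat.{u} R}, (A →ₗ[R] B) → (B →ₗ[R] D) → Prop)
    (hd : ∀ i, T (d (i + 1)) (d i)) (h₀ : T (d 0) ε)
    (h₁ : T ε (0 : N →ₗ[R] ModuleCat.of R PUnit.{u + 1}))
    (h₂ : ∀ {A : ModuleCat.{u} R} (f : A →ₗ[R] ModuleCat.of R PUnit.{u + 1}),
      T f (0 : ModuleCat.of R PUnit.{u + 1} →ₗ[R] ModuleCat.of R PUnit.{u + 1})) :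
    ∀ i : ℤ, T (augmentedD N d ε (i + 1)) (augmentedD N d ε i)
  | .ofNat n => hd n
  | .negSucc 0 => h₀
  | .negSucc 1 => h₁
  | .negSucc (_ + 2) => h₂ _

lemma isGCFlat_of_resolution (C : ModuleCat.{u} R) (d : ∀ i, P (i + 1) →ₗ[R] P i) (ε : P 0 →ₗ[R] N)
    (hP : ∀ i, Module.Flat R (P i)) (hN : IsCFlat R C N) (hε : Function.Surjective ε)
    (h₀ : Function.Exact (d 0) ε) (hd : ∀ i, Function.Exact (d (i + 1)) (d i))
    (hJ : ∀ J : ModuleCat.{u} R, IsCInjective R C J → ∀ i,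
      Function.Exact ((d (i + 1)).rTensor J) ((d i).rTensor J)) : IsGCFlat R C N := by
  have hexact := augmentedD_rel_succ d ε (fun f g => Function.Exact f g) hd h₀
    (fun x => by simpa using hε x) (fun f x => by simp [Subsingleton.elim x 0])
  refine ⟨⟨augmentedX P N, augmentedD N d ε, fun i => (hexact i).linearMap_comp_eq_zero⟩, hexact,
    ?_, ?_, fun J hJC => ?_, ?_⟩
  · rintro (i | i) hi
    · exact hP i
    · lia
  · rintro (i | _ | i) hi
    · lia
    · exact hN
    · exact ⟨ModuleCat.of R PUnit.{u + 1}, inferInstanceAs (Module.Flat R PUnit.{u + 1}),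
        ⟨LinearEquiv.ofSubsingleton PUnit.{u + 1} (PUnit.{u + 1} ⊗[R] C)⟩⟩
  · refine augmentedD_rel_succ d ε (fun f g => Function.Exact (f.rTensor J) (g.rTensor J))
      (hJ J hJC) (rTensor_exact _ h₀ hε) ?_ ?_
    · intro x
      simpa using LinearMap.rTensor_surjective J hε x
    · intro A f x
      have h : Subsingleton (PUnit.{u + 1} ⊗[R] J) := inferInstance
      exact iff_of_true (h.elim _ _) ⟨0, h.elim _ _⟩
  · exact ⟨((Submodule.quotEquivOfEq _ _ h₀.linearMap_ker_eq.symm).trans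
      (ε.quotKerEquivOfSurjective hε)).symm⟩

lemma IsCFlat.isGCFlat [IsNoetherianRing R] {C N : ModuleCat.{u} R} (hC : IsSemidualizing R C)
    (hN : IsCFlat R C N) : IsGCFlat R C N := by
  obtain ⟨F, hF, ⟨e⟩⟩ := id hN
  have := hC.1
  obtain ⟨P, d, ε, hP, hε, h₀, hd, hI⟩ :=
    exists_free_resolution C ((extZero_iff_extVanishes C C).1 hC.2.2)
  refine isGCFlat_of_resolution (P := fun i => ModuleCat.of R (F ⊗[R] P i)) C
    (fun i => (d i).lTensor F) (e.symm ∘ₗ ε.lTensor F)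
    (fun i => inferInstanceAs (Module.Flat R (F ⊗[R] P i))) hN
    (e.symm.surjective.comp (LinearMap.lTensor_surjective _ hε)) ?_
    (fun i => Module.Flat.lTensor_exact F (hd i)) ?_
  · exact (e.symm.injective.comp_exact_iff_exact).2
      (lTensor_exact F h₀ hε)
  · rintro J ⟨I, hIinj, ⟨eJ⟩⟩ i
    have h : Function.Exact ((d (i + 1)).rTensor J) ((d i).rTensor J) :=
      (Function.Exact.iff_of_ladder_linearEquiv (e₁ := eJ.lTensor _) (e₂ := eJ.lTensor _)
        (e₃ := eJ.lTensor _) (by ext; simp) (by ext; simp)).1 (hI I i)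
    exact (Function.Exact.iff_of_ladder_linearEquiv
      (e₁ := TensorProduct.assoc R F _ J) (e₂ := TensorProduct.assoc R F _ J)
      (e₃ := TensorProduct.assoc R F _ J) (by ext; simp) (by ext; simp)).1
      (Module.Flat.lTensor_exact F h)

end Resolution

section GCFlatVanishing

variable {R : Type u} [CommRing R]

lemma liftQ_rTensor_injective {A B D : Type u} [AddCommGroup A] [Module R A] [AddCommGroup B]
    [Module R B] [AddCommGroup D] [Module R D] (J : Type u) [AddCommGroup J] [Module R J]
    {f : A →ₗ[R] B} {g : B →ₗ[R] D} (hfg : LinearMap.range f ≤ LinearMap.ker g)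
    (h : Function.Exact (f.rTensor J) (g.rTensor J)) :
    Function.Injective (((LinearMap.range f).liftQ g hfg).rTensor J) := by
  rw [injective_iff_map_eq_zero]
  intro x hx
  obtain ⟨y, rfl⟩ := LinearMap.rTensor_surjective J (LinearMap.range f).mkQ_surjective x
  rw [← LinearMap.comp_apply, ← LinearMap.rTensor_comp, Submodule.liftQ_mkQ] at hx
  obtain ⟨z, rfl⟩ := (h y).1 hx
  rw [← LinearMap.comp_apply, ← LinearMap.rTensor_comp, LinearMap.range_mkQ_comp,
    LinearMap.rTensor_zero, LinearMap.zero_apply]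

lemma ZComplex.extVanishes_coker (Z : ZComplex R) (hZ : Z.IsExact)
    (hflat : ∀ i : ℤ, 0 ≤ i → Module.Flat R (Z.X i)) (J : ModuleCat.{u} R) (hJ : Z.TensorExact J)
    (i : ℤ) (hi : 0 ≤ i) :
    ExtVanishes R (Z.X i ⧸ LinearMap.range (Z.d i)) (CharacterModule J) := by
  intro n
  have hle (i : ℤ) : LinearMap.range (Z.d (i + 1)) ≤ LinearMap.ker (Z.d i) :=
    (hZ i).linearMap_ker_eq.ge
  have hinj (i : ℤ) : Function.Injective ((LinearMap.range (Z.d (i + 1))).liftQ (Z.d i) (hle i)) :=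
    LinearMap.ker_eq_bot.1 (Submodule.ker_liftQ_eq_bot _ _ _ (hZ i).linearMap_ker_eq.le)
  have hex (i : ℤ) : Function.Exact ((LinearMap.range (Z.d (i + 1))).liftQ (Z.d i) (hle i))
      (LinearMap.range (Z.d i)).mkQ := by
    rw [LinearMap.exact_iff, Submodule.ker_mkQ, Submodule.range_liftQ]
  have hext (i : ℤ) (hi : 0 ≤ i) : ExtVanishes R (Z.X i) (CharacterModule J) :=
    have := hflat i hi
    extVanishes_characterModule_of_flat J _
  induction n generalizing i with
  | zero =>
    exact subsingleton_ext_one_characterModule (hinj i) (hex i) (Submodule.mkQ_surjective _)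
      (hext i hi) (liftQ_rTensor_injective J (hle i) (hJ i))
  | succ n ih =>
    exact subsingleton_ext_succ_right (hinj i) (hex i) (Submodule.mkQ_surjective _)
      (hext i hi) _ (ih (i + 1) (by lia))

lemma IsGCFlat.extVanishes {C M : ModuleCat.{u} R} (h : IsGCFlat R C M) {J : ModuleCat.{u} R}
    (hJ : IsCInjective R C J) : ExtVanishes R M (CharacterModule J) := by
  obtain ⟨Z, hZ, hflat, -, hJZ, ⟨e⟩⟩ := h
  exact (Z.extVanishes_coker hZ hflat J (hJZ J hJ) 0 le_rfl).of_linearEquiv e.symm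

end GCFlatVanishing

section PureQuotient

variable {R : Type u} [CommRing R]

lemma lTensor_injective_of_injective_modules {A B : Type u} [AddCommGroup A] [Module R A]
    [Module.Flat R A] [AddCommGroup B] [Module R B] (f : A →ₗ[R] B)
    (h : ∀ (I : Type u) [AddCommGroup I] [Module R I] [Module.Injective R I],
      Function.Injective (f.lTensor I))
    (N : Type u) [AddCommGroup N] [Module R N] : Function.Injective (f.lTensor N) := by
  let I : ModuleCat.{u} R := Injective.under (ModuleCat.of R N)
  let j : N →ₗ[R] I := (Injective.ι (ModuleCat.of R N)).hom
  have hj : Function.Injective j := (ModuleCat.mono_iff_injective _).1 inferInstance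
  have : Module.Injective R I :=
    (Module.injective_iff_injective_object R I).2 (Injective.injective_under _)
  have h₁ := (h I).comp (Module.Flat.rTensor_preserves_injective_linearMap (M := A) j hj)
  rw [← LinearMap.coe_comp, LinearMap.lTensor_comp_rTensor, ← LinearMap.rTensor_comp_lTensor,
    LinearMap.coe_comp] at h₁
  exact h₁.of_comp

lemma flat_quotient_range {A B : Type u} [AddCommGroup A] [Module R A]
    [AddCommGroup B] [Module R B] [Module.Flat R B] (f : A →ₗ[R] B)
    (h : ∀ (N : Type u) [AddCommGroup N] [Module R N], Function.Injective (f.lTensor N)) :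
    Module.Flat R (B ⧸ LinearMap.range f) := by
  have hf : Function.Exact f (LinearMap.range f).mkQ := LinearMap.exact_map_mkQ_range f
  have hq := (LinearMap.range f).mkQ_surjective
  rw [Module.Flat.iff_rTensor_preserves_injective_linearMap]
  intro N N' _ _ _ _ j hj
  rw [injective_iff_map_eq_zero]
  intro x hx
  obtain ⟨y, rfl⟩ := LinearMap.lTensor_surjective N hq x
  rw [← LinearMap.comp_apply, LinearMap.rTensor_comp_lTensor, ← LinearMap.lTensor_comp_rTensor,
    LinearMap.comp_apply] at hx
  obtain ⟨z, hz⟩ := (lTensor_exact N' hf hq _).1 hx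
  have hjq := LinearMap.exact_map_mkQ_range j
  have hjs := (LinearMap.range j).mkQ_surjective
  have hz0 : (LinearMap.range j).mkQ.rTensor A z = 0 := by
    apply h (N' ⧸ LinearMap.range j)
    rw [map_zero, ← LinearMap.comp_apply, LinearMap.lTensor_comp_rTensor,
      ← LinearMap.rTensor_comp_lTensor, LinearMap.comp_apply, hz]
    exact (rTensor_exact B hjq hjs).apply_apply_eq_zero y
  obtain ⟨w, rfl⟩ := (rTensor_exact A hjq hjs z).1 hz0
  have hw : f.lTensor N w = y := by
    apply Module.Flat.rTensor_preserves_injective_linearMap (M := B) j hj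
    rw [← hz, ← LinearMap.comp_apply, ← LinearMap.comp_apply, LinearMap.lTensor_comp_rTensor,
      LinearMap.rTensor_comp_lTensor]
  rw [← hw]
  exact (lTensor_exact N hf hq).apply_apply_eq_zero w

end PureQuotient

section FlatCotorsion

variable {R : Type u} [CommRing R] {C : ModuleCat.{u} R}

lemma IsCFlatCotorsion.of_linearEquiv {M N : ModuleCat.{u} R} (e : M ≃ₗ[R] N)
    (h : IsCFlatCotorsion R C M) : IsCFlatCotorsion R C N := by
  obtain ⟨F, hF, hcot, ⟨e'⟩⟩ := h
  exact ⟨F, hF, hcot, ⟨e.symm.trans e'⟩⟩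

lemma IsCFlatCotorsion.isCFlat {M : ModuleCat.{u} R} (h : IsCFlatCotorsion R C M) :
    IsCFlat R C M := by
  obtain ⟨F, hF, -, e⟩ := h
  exact ⟨F, hF, e⟩

lemma IsCFlatCotorsion.hasResOfLength_zero {M : ModuleCat.{u} R} (h : IsCFlatCotorsion R C M) :
    HasResOfLength R (IsCFlatCotorsion R C) 0 M := by
  refine ⟨fun | 0 => M | _ + 1 => ModuleCat.of R PUnit.{u + 1}, fun _ => 0, LinearMap.id,
    Function.surjective_id, ?_, ?_, ?_, ?_⟩
  · intro x
    exact ⟨fun hx => ⟨0, hx.symm⟩, fun ⟨_, hx⟩ => hx.symm⟩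
  · intro i x
    exact iff_of_true rfl ⟨0, Subsingleton.elim (α := PUnit.{u + 1}) _ _⟩
  · intro i hi
    obtain rfl : i = 0 := by lia
    exact h
  · rintro (_ | i) hi
    · lia
    · exact inferInstanceAs (Subsingleton PUnit.{u + 1})

variable [IsNoetherianRing R]

lemma IsSemidualizing.mk_bijective (hC : IsSemidualizing R C) (F : Type u) [AddCommGroup F]
    [Module R F] [Module.Flat R F] : Function.Bijective (TensorProduct.mk R F C) := by
  have := hC.1
  have h : TensorProduct.mk R F C = lTensorHomToHomLTensor (.id R) C F C ∘ₗ
      (LinearMap.lsmul R C).lTensor F ∘ₗ (TensorProduct.rid R F).symm.toLinearMap := by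
    ext; simp
  rw [h]
  exact (lTensorHomToHomLTensor_bijective _ F C).comp
    (((LinearEquiv.ofBijective _ hC.2.1).lTensor F).bijective.comp
      (TensorProduct.rid R F).symm.bijective)

lemma IsSemidualizing.exists_rTensor_eq (hC : IsSemidualizing R C) {F G : Type u}
    [AddCommGroup F] [Module R F] [AddCommGroup G] [Module R G] [Module.Flat R G]
    (g : F ⊗[R] C →ₗ[R] G ⊗[R] C) : ∃ f : F →ₗ[R] G, g = f.rTensor C := by
  let e := LinearEquiv.ofBijective _ (hC.mk_bijective G)
  refine ⟨e.symm ∘ₗ TensorProduct.curry g, TensorProduct.ext' fun x c => ?_⟩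
  exact (LinearMap.congr_fun (e.apply_symm_apply (TensorProduct.curry g x)) c).symm

lemma IsSemidualizing.nonempty_tensor_hom_equiv (hC : IsSemidualizing R C) (I : Type u)
    [AddCommGroup I] [Module R I] [Module.Injective R I] :
    Nonempty (C ⊗[R] (C →ₗ[R] I) ≃ₗ[R] I) :=
  have := hC.1
  ⟨(LinearEquiv.ofBijective _ (tensorHomEval_bijective (R := R) C I C)).trans
    ((LinearEquiv.arrowCongr (LinearEquiv.ofBijective _ hC.2.1).symm (.refl R I)).trans
      (LinearMap.ringLmapEquivSelf R R I))⟩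

lemma lTensor_injective_of_rTensor_rTensor_hom (hC : IsSemidualizing R C) {F G : Type u}
    [AddCommGroup F] [Module R F] [AddCommGroup G] [Module R G] (f : F →ₗ[R] G) (I : Type u)
    [AddCommGroup I] [Module R I] [Module.Injective R I]
    (h : Function.Injective ((f.rTensor C).rTensor (C →ₗ[R] I))) :
    Function.Injective (f.lTensor I) := by
  obtain ⟨e⟩ := hC.nonempty_tensor_hom_equiv I
  rw [LinearMap.lTensor_inj_iff_rTensor_inj]
  have h₁ : Function.Injective (f.rTensor (C ⊗[R] (C →ₗ[R] I))) := by
    rw [LinearMap.rTensor_tensor]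
    exact (TensorProduct.assoc R G C _).injective.comp
      (h.comp (TensorProduct.assoc R F C _).symm.injective)
  have h₂ : f.rTensor I ∘ₗ e.lTensor F =
      e.lTensor G ∘ₗ f.rTensor (C ⊗[R] (C →ₗ[R] I)) := by
    ext; simp
  have h₃ : Function.Injective (f.rTensor I ∘ₗ (e.lTensor F).toLinearMap) := by
    rw [h₂]
    exact (e.lTensor G).injective.comp h₁
  exact (Function.Injective.of_comp_iff' _ (e.lTensor F).bijective).1 h₃

lemma isCFlatCotorsion_of_exact (hC : IsSemidualizing R C) {A B M : ModuleCat.{u} R}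
    {g : A →ₗ[R] B} {p : B →ₗ[R] M} (hA : IsCFlatCotorsion R C A) (hB : IsCFlatCotorsion R C B)
    (hg : Function.Injective g) (hgp : Function.Exact g p) (hp : Function.Surjective p)
    (hM : ∀ J : ModuleCat.{u} R, IsCInjective R C J → ExtVanishes R M (CharacterModule J)) :
    IsCFlatCotorsion R C M := by
  obtain ⟨F, hF, hFcot, ⟨eA⟩⟩ := hA
  obtain ⟨G, hG, hGcot, ⟨eB⟩⟩ := hB
  obtain ⟨f, hf⟩ := hC.exists_rTensor_eq (eB.toLinearMap ∘ₗ g ∘ₗ eA.symm.toLinearMap)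
  have hfinj : Function.Injective (f.rTensor C) := by
    rw [← hf]
    exact eB.injective.comp (hg.comp eA.symm.injective)
  have hfp : Function.Exact (f.rTensor C) (p ∘ₗ eB.symm.toLinearMap) := by
    refine (Function.Exact.iff_of_ladder_linearEquiv (e₁ := eA) (e₂ := eB) (e₃ := .refl R M)
      ?_ ?_).2 hgp
    · rw [← hf]; ext; simp
    · ext; simp
  have hps : Function.Surjective (p ∘ₗ eB.symm.toLinearMap) := hp.comp eB.symm.surjective
  have hfN (N : Type u) [AddCommGroup N] [Module R N] : Function.Injective (f.lTensor N) := by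
    refine lTensor_injective_of_injective_modules f (fun I _ _ _ => ?_) N
    refine lTensor_injective_of_rTensor_rTensor_hom hC f I
      (rTensor_injective_iff_lcomp_surjective.2 ?_)
    exact lcomp_surjective_of_extVanishes hfinj hfp hps
      (hM (ModuleCat.of R (C →ₗ[R] I)) ⟨ModuleCat.of R I, ‹_›, ⟨.refl R _⟩⟩)
  have hfq : Function.Exact f (LinearMap.range f).mkQ := LinearMap.exact_map_mkQ_range f
  have hq := (LinearMap.range f).mkQ_surjective
  have hf₀ : Function.Injective f := by
    have h := (LinearMap.lTensor_inj_iff_rTensor_inj R f).1 (hfN R)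
    have h' : f ∘ₗ (TensorProduct.rid R F).toLinearMap =
        (TensorProduct.rid R G).toLinearMap ∘ₗ f.rTensor R := by
      ext; simp
    have h'' : Function.Injective (f ∘ₗ (TensorProduct.rid R F).toLinearMap) := by
      rw [h']
      exact (TensorProduct.rid R G).injective.comp h
    exact (Function.Injective.of_comp_iff' _ (TensorProduct.rid R F).bijective).1 h''
  refine ⟨ModuleCat.of R (G ⧸ LinearMap.range f), flat_quotient_range f hfN, fun E hE => ?_, ⟨?_⟩⟩
  · exact (extZero_iff_extVanishes _ _).2 <| .cokernel hf₀ hfq hq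
      ((extZero_iff_extVanishes _ _).1 (hFcot E hE)) ((extZero_iff_extVanishes _ _).1 (hGcot E hE))
  · exact (hfp.linearEquivOfSurjective hps).symm.trans
      ((rTensor_exact C hfq hq).linearEquivOfSurjective (LinearMap.rTensor_surjective C hq))

lemma isCFlatCotorsion_of_hasResOfLength (hC : IsSemidualizing R C) (n : ℕ)
    (M : ModuleCat.{u} R) (hn : HasResOfLength R (IsCFlatCotorsion R C) n M)
    (hM : ∀ J : ModuleCat.{u} R, IsCInjective R C J → ExtVanishes R M (CharacterModule J)) :
    IsCFlatCotorsion R C M := by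
  induction n generalizing M with
  | zero =>
    obtain ⟨P, d, ε, hε, h₀, -, hP, hP'⟩ := hn
    have := hP' 1 one_pos
    have hinj : Function.Injective ε := by
      rw [injective_iff_map_eq_zero]
      intro x hx
      obtain ⟨y, rfl⟩ := (h₀ x).1 hx
      rw [Subsingleton.elim (α := P 1) y 0, map_zero]
    exact (hP 0 le_rfl).of_linearEquiv (.ofBijective ε ⟨hinj, hε⟩)
  | succ n ih =>
    obtain ⟨P, d, ε, hε, h₀, hd, hP, hP'⟩ := hn
    have hi := Submodule.injective_subtype (LinearMap.ker ε)
    have hie := LinearMap.exact_subtype_ker_map ε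
    have hP₀ := hP 0 (Nat.zero_le _)
    refine isCFlatCotorsion_of_exact (A := ModuleCat.of R (LinearMap.ker ε)) hC
      (ih _ ?_ fun J hJ => ?_) hP₀ hi hie hε hM
    · refine ⟨fun i => P (i + 1), fun i => d (i + 1),
        (d 0).codRestrict (LinearMap.ker ε) h₀.apply_apply_eq_zero, ?_, ?_, fun i => hd (i + 1),
        fun i hi => hP _ (by lia), fun i hi => hP' _ (by lia)⟩
      · rintro ⟨x, hx⟩
        obtain ⟨y, rfl⟩ := (h₀ x).1 hx
        exact ⟨y, rfl⟩
      · exact fun x => Subtype.ext_iff.trans (hd 0 x)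
    · exact .kernel hi hie hε ((hP₀.isCFlat.isGCFlat hC).extVanishes hJ) (hM J hJ)

end FlatCotorsion

/-- `M` is `C`-flat `C`-cotorsion iff `M` is `G_C`-flat and has finite
`C`-flat `C`-cotorsion projective dimension. -/
theorem stmt2 (R : Type u) [CommRing R] [IsNoetherianRing R]
    (C : ModuleCat.{u} R) (hC : IsSemidualizing R C) (M : ModuleCat.{u} R) :
    IsCFlatCotorsion R C M ↔
      (IsGCFlat R C M ∧ ∃ n, HasResOfLength R (IsCFlatCotorsion R C) n M) := by
  refine ⟨fun h => ⟨h.isCFlat.isGCFlat hC, 0, h.hasResOfLength_zero⟩, fun ⟨h, n, hn⟩ => ?_⟩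
  exact isCFlatCotorsion_of_hasResOfLength hC n M hn fun J hJ => h.extVanishes hJ
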